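/- arXiv:1004.1825 — 6 statements merged into one kernel-verified Lean document; each statement's English description precedes it below -/
import Mathlib

section
/- Let G be a finite group, X a finite G-set with the discrete topology, and g ∈ G. Let E_g be the quotient topological space of ℝ × X by the equivalence relation generated by (t + 2π, x) ∼ (t, g⁻¹ • x). Then for every x ∈ X and t ∈ ℝ, the connected component of ⟦(t,x)⟧ in E_g is exactly the image under the quotient map of ℝ × O, where O ⊆ X is the orbit of x under the cyclic subgroup ⟨g⟩ generated by g. -/
noncomputable section

/-- The relation on `ℝ × X` whose generated equivalence relation identifies
`(t + 2π, x)` with `(t, g⁻¹ • x)`. -/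
def EgRel (G : Type) [Group G] (X : Type) [MulAction G X] (g : G) :
    ℝ × X → ℝ × X → Prop :=
  fun a b => ∃ (t : ℝ) (x : X), a = (t + 2 * Real.pi, x) ∧ b = (t, g⁻¹ • x)

/-- The total space `E_g`: the quotient of `ℝ × X` by the equivalence relation generated by
`(t + 2π, x) ∼ (t, g⁻¹ • x)`, with the quotient topology. -/
abbrev Eg (G : Type) [Group G] (X : Type) [TopologicalSpace X] [MulAction G X] (g : G) :
    Type :=
  Quot (EgRel G X g)

theorem Eg.mk_add_two_pi {G : Type} [Group G] {X : Type} [MulAction G X] (g : G) (s : ℝ) (x : X) :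
    Quot.mk (EgRel G X g) (s + 2 * Real.pi, x) = Quot.mk (EgRel G X g) (s, g⁻¹ • x) :=
  Quot.sound ⟨s, x, rfl, rfl⟩

theorem Eg.mk_zpow_smul {G : Type} [Group G] {X : Type} [MulAction G X] (g : G) (n : ℤ)
    (s : ℝ) (x : X) :
    Quot.mk (EgRel G X g) (s, g ^ n • x) = Quot.mk (EgRel G X g) (s - n * (2 * Real.pi), x) := by
  induction n generalizing s with
  | zero => simp
  | succ k ih =>
    have h := Eg.mk_add_two_pi g (s - 2 * Real.pi) (g ^ ((k : ℤ) + 1) • x)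
    rw [sub_add_cancel, smul_smul, ← zpow_neg_one, ← zpow_add, neg_add_cancel_comm_assoc] at h
    rw [h, ih]
    push_cast
    ring_nf
  | pred k ih =>
    have h := Eg.mk_add_two_pi g s (g ^ (-(k : ℤ)) • x)
    rw [smul_smul, ← zpow_neg_one, ← zpow_add, neg_add_eq_sub] at h
    rw [← h, ih]
    push_cast
    ring_nf

theorem EgRel.mem_orbit_zpowers_iff {G : Type} [Group G] {X : Type} [MulAction G X] {g : G}
    {a b : ℝ × X} (h : EgRel G X g a b) (x : X) :
    a.2 ∈ MulAction.orbit (Subgroup.zpowers g) x ↔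
      b.2 ∈ MulAction.orbit (Subgroup.zpowers g) x := by
  obtain ⟨s, y, rfl, rfl⟩ := h
  have h : MulAction.orbit (Subgroup.zpowers g) (g⁻¹ • y) =
      MulAction.orbit (Subgroup.zpowers g) y :=
    MulAction.orbit_smul
      (⟨g⁻¹, inv_mem (Subgroup.mem_zpowers g)⟩ : Subgroup.zpowers g) y
  rw [← MulAction.orbit_eq_iff, ← MulAction.orbit_eq_iff, h]

theorem Eg.preimage_image_univ_prod_orbit {G : Type} [Group G] {X : Type} [MulAction G X]
    (g : G) (x : X) :
    Quot.mk (EgRel G X g) ⁻¹' (Quot.mk (EgRel G X g) ''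
        (Set.univ ×ˢ MulAction.orbit (Subgroup.zpowers g) x)) =
      Set.univ ×ˢ MulAction.orbit (Subgroup.zpowers g) x := by
  refine (Set.subset_preimage_image _ _).antisymm' ?_
  rintro a ⟨b, hb, hab⟩
  have h := congrArg (Quot.lift (fun a : ℝ × X => a.2 ∈ MulAction.orbit (Subgroup.zpowers g) x)
    fun _ _ h => propext (h.mem_orbit_zpowers_iff x)) hab
  exact ⟨trivial, h.mp hb.2⟩

theorem Eg.isClopen_image_univ_prod_orbit {G : Type} [Group G] {X : Type} [TopologicalSpace X]
    [DiscreteTopology X] [MulAction G X] (g : G) (x : X) :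
    IsClopen (Quot.mk (EgRel G X g) ''
      (Set.univ ×ˢ MulAction.orbit (Subgroup.zpowers g) x)) := by
  rw [← isQuotientMap_quot_mk.isClopen_preimage, Eg.preimage_image_univ_prod_orbit]
  exact isClopen_univ.prod (isClopen_discrete _)

/-- The connected component of `⟦(t,x)⟧` in `E_g` is the image under the quotient map of
`ℝ × O`, where `O` is the orbit of `x` under the cyclic subgroup `⟨g⟩`. -/
theorem connectedComponent_eq_image_of_orbit
    (G : Type) [Group G] [Fintype G]
    (X : Type) [Fintype X] [TopologicalSpace X] [DiscreteTopology X] [MulAction G X]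
    (g : G) (t : ℝ) (x : X) :
    connectedComponent (Quot.mk (EgRel G X g) (t, x)) =
      Quot.mk (EgRel G X g) ''
        (Set.prod Set.univ (MulAction.orbit (Subgroup.zpowers g) x)) := by
  apply Set.Subset.antisymm
  · exact (Eg.isClopen_image_univ_prod_orbit g x).connectedComponent_subset
      ⟨(t, x), ⟨trivial, MulAction.mem_orbit_self x⟩, rfl⟩
  · rintro _ ⟨⟨s, _⟩, ⟨-, ⟨⟨_, n, rfl⟩, rfl⟩⟩, rfl⟩
    have hcont : Continuous fun r : ℝ => Quot.mk (EgRel G X g) (r, x) :=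
      continuous_quot_mk.comp (by fun_prop)
    refine (isPreconnected_range hcont).subset_connectedComponent ⟨t, rfl⟩ ?_
    exact ⟨s - n * (2 * Real.pi), (Eg.mk_zpow_smul g n s x).symm⟩
end
end

section
/- Let G be a finite group, X a finite G-set with the discrete topology, g ∈ G, and E_g the quotient of ℝ × X by the equivalence relation generated by (t + 2π, x) ∼ (t, g⁻¹ • x). Fix x ∈ X and let m be the cardinality of the orbit of x under the cyclic subgroup ⟨g⟩. Then the map ℝ → E_g, t ↦ ⟦(t,x)⟧, descends to a well-defined continuous map on ℝ/(2πm)ℤ which is a topological embedding whose image is the connected component of ⟦(0,x)⟧ in E_g. In particular, every connected component of E_g is homeomorphic to a circle. -/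
noncomputable section

/-- Two pairs have the same class in `E_g` iff they differ by a power of the deck transformation
`(t, x) ↦ (t + 2π, g • x)`. -/
theorem Eg.mk_eq_mk_iff {G : Type} [Group G] {X : Type} [TopologicalSpace X] [MulAction G X]
    {g : G} {a b : ℝ × X} :
    (Quot.mk (EgRel G X g) a : Eg G X g) = Quot.mk (EgRel G X g) b ↔
      ∃ k : ℤ, b.1 = a.1 + 2 * Real.pi * k ∧ b.2 = g ^ k • a.2 := by
  constructor
  · intro h
    have h' := Quot.eqvGen_exact h
    clear h
    induction h' with
    | rel a b hab =>
      obtain ⟨t, x, rfl, rfl⟩ := hab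
      exact ⟨-1, by push_cast; ring, by simp⟩
    | refl a => exact ⟨0, by simp, by simp⟩
    | symm a b _ ih =>
      obtain ⟨k, h1, h2⟩ := ih
      exact ⟨-k, by rw [h1]; push_cast; ring, by simp [h2]⟩
    | trans a b c _ _ ih1 ih2 =>
      obtain ⟨k, h1, h2⟩ := ih1
      obtain ⟨l, h3, h4⟩ := ih2
      exact ⟨l + k, by rw [h3, h1]; push_cast; ring, by rw [h4, h2, zpow_add, mul_smul]⟩
  · have step : ∀ (t : ℝ) (x : X), (Quot.mk (EgRel G X g) (t + 2 * Real.pi, g • x) : Eg G X g) =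
        Quot.mk (EgRel G X g) (t, x) :=
      fun t x => Quot.sound ⟨t, g • x, rfl, by simp⟩
    obtain ⟨t, x⟩ := a
    obtain ⟨s, y⟩ := b
    rintro ⟨k, rfl, rfl⟩
    induction k with
    | zero => simp
    | succ n ih =>
      rw [ih, ← step]
      congr 2
      · push_cast; ring
      · rw [add_comm, zpow_add, mul_smul, zpow_one]
    | pred n ih =>
      rw [ih, ← step _ (g ^ (-(n : ℤ) - 1) • x)]
      congr 2
      · push_cast; ring
      · rw [← mul_smul, ← zpow_one_add]
        congr 2
        ring

/-- The path `t ↦ ⟦(t, x)⟧` descends to an open embedding of the circle of length `2πm` onto the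
connected component of `⟦(0, x)⟧`, where `m` is the size of the `⟨g⟩`-orbit of `x`. -/
theorem Eg.exists_isOpenEmbedding {G : Type} [Group G] {X : Type} [TopologicalSpace X]
    [DiscreteTopology X] [MulAction G X] (g : G) (x : X) (m : ℕ)
    (hm : m = Nat.card (MulAction.orbit (Subgroup.zpowers g) x)) :
    ∃ f : AddCircle (2 * Real.pi * (m : ℝ)) → Eg G X g,
      (∀ t : ℝ, f (t : AddCircle (2 * Real.pi * (m : ℝ))) = Quot.mk (EgRel G X g) (t, x)) ∧
      Topology.IsOpenEmbedding f ∧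
      Set.range f = connectedComponent (Quot.mk (EgRel G X g) ((0 : ℝ), x)) := by
  have hdvd : ∀ k : ℤ, g ^ k • x = x ↔ (m : ℤ) ∣ k := by
    intro k
    rw [MulAction.zpow_smul_eq_iff_minimalPeriod_dvd, hm, Nat.card_congr
      (MulAction.orbitZPowersEquiv g x), Nat.card_zmod]
  have hper : Function.Periodic (fun t : ℝ => (Quot.mk (EgRel G X g) (t, x) : Eg G X g))
      (2 * Real.pi * (m : ℝ)) := by
    intro t
    refine (Eg.mk_eq_mk_iff.2 ⟨m, by simp, ?_⟩).symm
    exact ((hdvd m).2 dvd_rfl).symm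
  have hf : ∀ t : ℝ, hper.lift (t : AddCircle (2 * Real.pi * (m : ℝ))) =
      Quot.mk (EgRel G X g) (t, x) := fun t => hper.lift_coe t
  have hpath : Continuous fun t : ℝ => (Quot.mk (EgRel G X g) (t, x) : Eg G X g) :=
    continuous_quot_mk.comp (by fun_prop)
  have hcont : Continuous hper.lift := continuous_quot_lift _ hpath
  have hinj : Function.Injective hper.lift := by
    intro a b
    induction a using QuotientAddGroup.induction_on with | _ t
    induction b using QuotientAddGroup.induction_on with | _ s
    intro h
    rw [hf, hf, Eg.mk_eq_mk_iff] at h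
    obtain ⟨k, h1, h2⟩ := h
    obtain ⟨l, rfl⟩ := (hdvd k).1 h2.symm
    rw [QuotientAddGroup.eq, AddSubgroup.mem_zmultiples_iff]
    refine ⟨l, ?_⟩
    dsimp only at h1
    rw [h1, zsmul_eq_mul]
    push_cast
    ring
  have hopen : IsOpenMap hper.lift := by
    intro U hU
    have hV : IsOpen ((fun t : ℝ => (t : AddCircle (2 * Real.pi * (m : ℝ)))) ⁻¹' U) :=
      hU.preimage (AddCircle.continuous_mk' _)
    rw [← isQuotientMap_quot_mk.isOpen_preimage]
    have : Quot.mk (EgRel G X g) ⁻¹' (hper.lift '' U) =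
        ⋃ k : ℤ, ((fun s : ℝ => s - 2 * Real.pi * k) ⁻¹'
          ((fun t : ℝ => (t : AddCircle (2 * Real.pi * (m : ℝ)))) ⁻¹' U)) ×ˢ {g ^ k • x} := by
      ext ⟨s, y⟩
      simp only [Set.mem_preimage, Set.mem_image, Set.mem_iUnion, Set.mem_prod,
        Set.mem_singleton_iff]
      constructor
      · rintro ⟨a, ha, h⟩
        induction a using QuotientAddGroup.induction_on with | _ t
        rw [hf, Eg.mk_eq_mk_iff] at h
        obtain ⟨k, h1, h2⟩ := h
        dsimp only at h1 h2
        exact ⟨k, by rwa [h1, add_sub_cancel_right], h2⟩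
      · rintro ⟨k, h1, h2⟩
        refine ⟨_, h1, ?_⟩
        rw [hf, Eg.mk_eq_mk_iff]
        exact ⟨k, by simp, h2⟩
    rw [this]
    exact isOpen_iUnion fun k => (hV.preimage (by fun_prop)).prod (isOpen_discrete _)
  refine ⟨hper.lift, hf, .of_continuous_injective_isOpenMap hcont hinj hopen, ?_⟩
  have hrange : Set.range hper.lift =
      Set.range fun t : ℝ => (Quot.mk (EgRel G X g) (t, x) : Eg G X g) := by
    rw [← (QuotientAddGroup.mk_surjective).range_comp]
    rfl
  have hclosed : IsClosed (Set.range hper.lift) := by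
    rw [← isQuotientMap_quot_mk.isClosed_preimage]
    have : Quot.mk (EgRel G X g) ⁻¹' (Set.range hper.lift) =
        Prod.snd ⁻¹' (Set.range fun k : ℤ => g ^ k • x) := by
      ext ⟨s, y⟩
      simp only [hrange, Set.mem_preimage, Set.mem_range]
      constructor
      · rintro ⟨t, h⟩
        obtain ⟨k, -, h2⟩ := Eg.mk_eq_mk_iff.1 h
        exact ⟨k, h2.symm⟩
      · rintro ⟨k, h⟩
        exact ⟨s - 2 * Real.pi * k, Eg.mk_eq_mk_iff.2 ⟨k, by simp, h.symm⟩⟩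
    rw [this]
    exact (isClosed_discrete _).preimage continuous_snd
  have hmem : (Quot.mk (EgRel G X g) ((0 : ℝ), x) : Eg G X g) ∈ Set.range hper.lift :=
    ⟨_, hf 0⟩
  refine Set.Subset.antisymm ?_ ?_
  · refine IsPreconnected.subset_connectedComponent ?_ hmem
    rw [hrange]
    exact isPreconnected_range hpath
  · exact IsClopen.connectedComponent_subset ⟨hclosed, hopen.isOpen_range⟩ hmem

/-- With `m` the cardinality of the `⟨g⟩`-orbit of `x`, the map `t ↦ ⟦(t,x)⟧` descends to a
well-defined continuous map `ℝ/(2πm)ℤ → E_g` which is a topological embedding with image the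
connected component of `⟦(0,x)⟧`; in particular every connected component of `E_g` is
homeomorphic to a circle. -/
theorem component_homeomorphic_circle
    (G : Type) [Group G] [Fintype G]
    (X : Type) [Fintype X] [TopologicalSpace X] [DiscreteTopology X] [MulAction G X]
    (g : G) (x : X) (m : ℕ)
    (hm : m = Nat.card (MulAction.orbit (Subgroup.zpowers g) x)) :
    (∃ f : AddCircle (2 * Real.pi * (m : ℝ)) → Eg G X g,
      Continuous f ∧
      (∀ t : ℝ, f (t : AddCircle (2 * Real.pi * (m : ℝ))) = Quot.mk (EgRel G X g) (t, x)) ∧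
      Topology.IsEmbedding f ∧
      Set.range f = connectedComponent (Quot.mk (EgRel G X g) ((0 : ℝ), x))) ∧
    ∀ y : Eg G X g,
      Nonempty (↥(connectedComponent y) ≃ₜ AddCircle (2 * Real.pi)) := by
  refine ⟨?_, fun y => ?_⟩
  · obtain ⟨f, hf, hemb, hrange⟩ := Eg.exists_isOpenEmbedding g x m hm
    exact ⟨f, hemb.continuous, hf, hemb.isEmbedding, hrange⟩
  · obtain ⟨⟨s, z⟩, rfl⟩ := Quot.exists_rep y
    obtain ⟨f, hf, hemb, hrange⟩ := Eg.exists_isOpenEmbedding g z _ rfl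
    have hcomp : connectedComponent (Quot.mk (EgRel G X g) (s, z)) = Set.range f := by
      rw [hrange]
      refine (connectedComponent_eq ?_).symm
      rw [← hrange]
      exact ⟨_, hf s⟩
    have := (MulAction.nonempty_orbit (M := Subgroup.zpowers g) z).to_subtype
    have hcard : (Nat.card (MulAction.orbit (Subgroup.zpowers g) z) : ℝ) ≠ 0 :=
      Nat.cast_ne_zero.2 Nat.card_pos.ne'
    exact ⟨(Homeomorph.setCongr hcomp).trans (hemb.isEmbedding.toHomeomorph.symm.trans
      (AddCircle.homeomorphAddCircle _ _ (mul_ne_zero Real.two_pi_pos.ne' hcard)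
        Real.two_pi_pos.ne'))⟩
end
end

section
/- Let G be a finite group, X a finite G-set with the discrete topology, and g, h ∈ G. Let E_g and E_{hgh⁻¹} be the quotients of ℝ × X by the equivalence relations generated by (t + 2π, x) ∼ (t, g⁻¹ • x) and (t + 2π, x) ∼ (t, (hgh⁻¹)⁻¹ • x) respectively, and let Φ_h : E_g → E_{hgh⁻¹} be the homeomorphism ⟦(t,x)⟧ ↦ ⟦(t, h • x)⟧. Under the bijections identifying the connected components of E_g with the orbits of X under ⟨g⟩ (sending ⟦(t,x)⟧ to the ⟨g⟩-orbit of x) and the connected components of E_{hgh⁻¹} with the orbits of X under ⟨hgh⁻¹⟩, the map on connected components induced by Φ_h corresponds to the map on orbits sending an orbit O of ⟨g⟩ to the orbit h • O = {h • y : y ∈ O} of ⟨hgh⁻¹⟩. -/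
open scoped Pointwise

noncomputable section

/-- Translation by `h` carries the `⟨g⟩`-orbit of `x` onto the `⟨hgh⁻¹⟩`-orbit of `h • x`. -/
theorem smul_orbit_zpowers {G X : Type*} [Group G] [MulAction G X] (g h : G) (x : X) :
    h • MulAction.orbit (Subgroup.zpowers g) x =
      MulAction.orbit (Subgroup.zpowers (h * g * h⁻¹)) (h • x) := by
  ext y
  simp only [Set.mem_smul_set, MulAction.mem_orbit_iff, Subtype.exists, Subgroup.mk_smul,
    Subgroup.mem_zpowers_iff, exists_prop, exists_exists_eq_and, conj_zpow, smul_smul,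
    inv_mul_cancel_right]

/-- Under the identification of connected components of `E_g` with `⟨g⟩`-orbits and of
connected components of `E_{hgh⁻¹}` with `⟨hgh⁻¹⟩`-orbits, the map induced on connected
components by the homeomorphism `Φ_h : ⟦(t,x)⟧ ↦ ⟦(t, h • x)⟧` corresponds to the map on
orbits `O ↦ h • O`. -/
theorem componentMap_corresponds_to_orbitMap
    (G : Type) [Group G] [Fintype G]
    (X : Type) [Fintype X] [TopologicalSpace X] [DiscreteTopology X] [MulAction G X]
    (g h : G)
    (φ : Eg G X g ≃ₜ Eg G X (h * g * h⁻¹))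
    (hφ : ∀ (t : ℝ) (x : X),
      φ (Quot.mk (EgRel G X g) (t, x)) = Quot.mk (EgRel G X (h * g * h⁻¹)) (t, h • x))
    (e₁ : ConnectedComponents (Eg G X g) ≃
      MulAction.orbitRel.Quotient (Subgroup.zpowers g) X)
    (he₁ : ∀ (t : ℝ) (x : X),
      e₁ (ConnectedComponents.mk (Quot.mk (EgRel G X g) (t, x))) =
        Quotient.mk (MulAction.orbitRel (Subgroup.zpowers g) X) x)
    (e₂ : ConnectedComponents (Eg G X (h * g * h⁻¹)) ≃
      MulAction.orbitRel.Quotient (Subgroup.zpowers (h * g * h⁻¹)) X)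
    (he₂ : ∀ (t : ℝ) (x : X),
      e₂ (ConnectedComponents.mk (Quot.mk (EgRel G X (h * g * h⁻¹)) (t, x))) =
        Quotient.mk (MulAction.orbitRel (Subgroup.zpowers (h * g * h⁻¹)) X) x) :
    ∀ (t : ℝ) (x : X),
      MulAction.orbitRel.Quotient.orbit
          (e₂ (ConnectedComponents.mk (φ (Quot.mk (EgRel G X g) (t, x))))) =
        h • MulAction.orbitRel.Quotient.orbit
          (e₁ (ConnectedComponents.mk (Quot.mk (EgRel G X g) (t, x)))) := by
  intro t x
  rw [hφ, he₁, he₂]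
  exact (smul_orbit_zpowers g h x).symm
end
end

section
/- Let G be a finite group with the discrete topology and let p : E → ℝ/2πℤ be a covering map of a nonempty topological space E, equipped with a continuous left G-action on E such that p(k • e) = p(e) for all k ∈ G and e ∈ E, and such that G acts simply transitively on each fiber of p. Then there exist g ∈ G and a G-equivariant homeomorphism φ : E → P_g with p = p_g ∘ φ, where P_g is the quotient of ℝ × G by the equivalence relation generated by (t + 2π, h) ∼ (t, hg), carrying the G-action k • ⟦(t,h)⟧ = ⟦(t,kh)⟧ and projection p_g induced by (t,h) ↦ t + 2πℤ. In other words, every principal G-cover of the circle is isomorphic to P_g for some g ∈ G. -/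
noncomputable section

/-- The relation on `ℝ × G` whose generated equivalence relation identifies
`(t + 2π, h)` with `(t, h * g)`. -/
def PgRel (G : Type) [Group G] (g : G) : ℝ × G → ℝ × G → Prop :=
  fun a b => ∃ (t : ℝ) (h : G), a = (t + 2 * Real.pi, h) ∧ b = (t, h * g)

/-- The total space `P_g` of the principal `G`-bundle over the circle with monodromy `g`:
the quotient of `ℝ × G` by the equivalence relation generated by `(t + 2π, h) ∼ (t, h * g)`. -/
abbrev Pg (G : Type) [Group G] [TopologicalSpace G] (g : G) : Type :=
  Quot (PgRel G g)

/-- The left `G`-action on `P_g` given by `k • ⟦(t,h)⟧ = ⟦(t, k * h)⟧`. -/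
def PgSMul (G : Type) [Group G] (g : G) (k : G) : Quot (PgRel G g) → Quot (PgRel G g) :=
  Quot.lift (fun p => Quot.mk (PgRel G g) (p.1, k * p.2))
    (by
      rintro a b ⟨t, h, rfl, rfl⟩
      exact Quot.sound ⟨t, k * h, rfl, by rw [mul_assoc]⟩)

/-- The projection `P_g → ℝ/2πℤ` induced by `(t, h) ↦ t + 2πℤ`. -/
def PgProj (G : Type) [Group G] (g : G) : Quot (PgRel G g) → AddCircle (2 * Real.pi) :=
  Quot.lift (fun p => ((p.1 : ℝ) : AddCircle (2 * Real.pi)))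
    (by
      rintro a b ⟨t, h, rfl, rfl⟩
      simp [AddCircle.coe_add_period (2 * Real.pi) t])

/-- Going around the circle `n` times multiplies the group coordinate of `P_g` by `g ^ n`. -/
theorem Pg_mk_add_zsmul {G : Type} [Group G] (g : G) (n : ℤ) (t : ℝ) (h : G) :
    Quot.mk (PgRel G g) (t + n • (2 * Real.pi), h) = Quot.mk (PgRel G g) (t, h * g ^ n) := by
  have step (s : ℝ) (k : G) :
      Quot.mk (PgRel G g) (s + 2 * Real.pi, k) = Quot.mk (PgRel G g) (s, k * g) :=
    Quot.sound ⟨s, k, rfl, rfl⟩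
  induction n generalizing h with
  | zero => simp
  | succ n ih =>
    rw [add_zsmul, one_zsmul, ← add_assoc, step, ih, mul_assoc, ← zpow_one_add, add_comm]
  | pred n ih =>
    have h₁ := step (t + (-(n : ℤ) - 1) • (2 * Real.pi)) (h * g⁻¹)
    rw [inv_mul_cancel_right, add_assoc, ← add_one_zsmul, sub_add_cancel, ih] at h₁
    rw [← h₁, mul_assoc, ← zpow_neg_one, ← zpow_add, sub_eq_neg_add, add_comm (-1)]

/-- A covering map over the circle with nonempty total space is covered by a line: the
universal covering `ℝ → ℝ/Tℤ` lifts through it. -/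
theorem IsCoveringMap.exists_lift_coe_addCircle {E : Type*} [TopologicalSpace E] [Nonempty E]
    {T : ℝ} {p : E → AddCircle T} (hp : IsCoveringMap p) :
    ∃ σ : C(ℝ, E), ∀ t : ℝ, p (σ t) = (t : AddCircle T) := by
  obtain ⟨e₀⟩ := ‹Nonempty E›
  obtain ⟨t₀, ht₀⟩ := QuotientAddGroup.mk_surjective (p e₀)
  obtain ⟨σ, ⟨-, hσ⟩, -⟩ := hp.existsUnique_continuousMap_lifts
    ⟨((↑) : ℝ → AddCircle T), AddCircle.continuous_mk' T⟩ t₀ e₀ ht₀.symm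
  exact ⟨σ, fun t => congrFun hσ t⟩

/-- A covering of the circle with fiberwise transitive continuous action of `G` has a monodromy
element relative to any lift of the universal covering. -/
theorem IsCoveringMap.exists_monodromy_smul {G E : Type*} [Group G] [TopologicalSpace E]
    [MulAction G E] {T : ℝ} {p : E → AddCircle T} (hp : IsCoveringMap p)
    (hcont : ∀ k : G, Continuous fun e : E => k • e)
    (hinv : ∀ (k : G) (e : E), p (k • e) = p e)
    (htrans : ∀ e e' : E, p e = p e' → ∃ k : G, k • e = e')
    (σ : C(ℝ, E)) (hσ : ∀ t : ℝ, p (σ t) = (t : AddCircle T)) :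
    ∃ g : G, ∀ t : ℝ, σ (t + T) = g • σ t := by
  obtain ⟨g, hg⟩ := htrans (σ 0) (σ (0 + T)) (by simp [hσ, AddCircle.coe_period])
  refine ⟨g, congrFun (hp.eq_of_comp_eq (g₁ := fun t => σ (t + T)) (g₂ := fun t => g • σ t)
    (by fun_prop) ((hcont g).comp σ.continuous) ?_ 0 hg.symm)⟩
  funext t
  simp [hσ, hinv]

/-- Classification of principal `G`-covers of the circle: any covering `p : E → ℝ/2πℤ` with a
continuous `G`-action preserving the fibers and acting simply transitively on each fiber is
`G`-equivariantly isomorphic to `P_g` for some `g ∈ G`. -/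
theorem principal_cover_of_circle_iso_pg
    (G : Type) [Group G] [Fintype G] [TopologicalSpace G] [DiscreteTopology G]
    (E : Type) [TopologicalSpace E] [Nonempty E] [MulAction G E]
    (hcont : ∀ k : G, Continuous fun e : E => k • e)
    (p : E → AddCircle (2 * Real.pi))
    (hp : IsCoveringMap p)
    (hinv : ∀ (k : G) (e : E), p (k • e) = p e)
    (htrans : ∀ e e' : E, p e = p e' → ∃! k : G, k • e = e') :
    ∃ (g : G) (φ : E ≃ₜ Pg G g),
      (∀ (k : G) (e : E), φ (k • e) = PgSMul G g k (φ e)) ∧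
      ∀ e : E, PgProj G g (φ e) = p e := by
  obtain ⟨σ, hσ⟩ := hp.exists_lift_coe_addCircle
  obtain ⟨g, hg⟩ := hp.exists_monodromy_smul hcont hinv (fun e e' h => (htrans e e' h).exists) σ hσ
  let F : ℝ × G → E := fun x => x.2 • σ x.1
  have hpF (x : ℝ × G) : p (F x) = (x.1 : AddCircle (2 * Real.pi)) := by simp [F, hinv, hσ]
  have hF_cont : Continuous F :=
    continuous_prod_of_discrete_right.2 fun h => (hcont h).comp σ.continuous
  have hF_open : IsOpenMap F := by
    refine isOpenMap_prod_of_discrete_right.2 fun h => ?_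
    refine (IsLocalHomeomorph.of_comp (g := p) ?_ hp.isLocalHomeomorph
      ((hcont h).comp σ.continuous)).isOpenMap
    convert AddCircle.isLocalHomeomorph_coe (2 * Real.pi) using 1
    exact funext fun t => hpF (t, h)
  have hF_rel (a b : ℝ × G) (hab : PgRel G g a b) : F a = F b := by
    obtain ⟨t, h, rfl, rfl⟩ := hab
    simp [F, hg, mul_smul]
  let ψ : Pg G g → E := Quot.lift F hF_rel
  have hψ_inj : Function.Injective ψ := by
    rintro ⟨t, h⟩ ⟨t', h'⟩ hxy
    obtain ⟨n, hn⟩ : ∃ n : ℤ, n • (2 * Real.pi) = t' - t := by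
      rw [← AddCircle.coe_eq_zero_iff, AddCircle.coe_sub, sub_eq_zero]
      exact (hpF (t', h')).symm.trans ((congrArg p hxy.symm).trans (hpF (t, h)))
    obtain rfl : t' = t + n • (2 * Real.pi) := by rw [hn]; ring
    rw [Pg_mk_add_zsmul] at hxy ⊢
    have heq : h • σ t = (h' * g ^ n) • σ t := hxy
    rw [(htrans (σ t) (h • σ t) (hinv h _).symm).unique rfl heq.symm]
  have hψ_surj : Function.Surjective ψ := fun e => by
    obtain ⟨t, ht⟩ := QuotientAddGroup.mk_surjective (p e)
    obtain ⟨k, hk, -⟩ := htrans (σ t) e ((hσ t).trans ht)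
    exact ⟨Quot.mk _ (t, k), hk⟩
  have hψ_open : IsOpenMap ψ := .of_comp continuous_quot_mk Quot.mk_surjective hF_open
  let Ψ : Pg G g ≃ₜ E := (Equiv.ofBijective ψ ⟨hψ_inj, hψ_surj⟩).toHomeomorphOfContinuousOpen
    (continuous_quot_lift hF_rel hF_cont) hψ_open
  refine ⟨g, Ψ.symm, fun k e => ?_, fun e => ?_⟩
  · obtain ⟨x, rfl⟩ := Ψ.surjective e
    rw [Ψ.symm_apply_apply, Ψ.symm_apply_eq]
    obtain ⟨t, h⟩ := x
    exact (mul_smul k h (σ t)).symm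
  · obtain ⟨x, rfl⟩ := Ψ.surjective e
    rw [Ψ.symm_apply_apply]
    obtain ⟨x⟩ := x
    exact (hpF x).symm
end
end

section
/- Let G be a group acting on a finite set X, let g₁, g₂ ∈ G, and let o ⊆ X be an orbit of the subgroup ⟨g₁, g₂⟩ generated by g₁ and g₂. For h ∈ G let b_h^o denote the number of orbits of the cyclic subgroup ⟨h⟩ that are contained in o. Then b_{g₁}^o + b_{g₂}^o + b_{g₁g₂}^o ≡ |o| (mod 2); equivalently, the quantity (2 − b_{g₁}^o − b_{g₂}^o − b_{g₁g₂}^o + |o|) is an even integer. (This is the integrality of the genus formula of Lemma 2.8: the connected component of the induced cover of the three-holed sphere corresponding to o is a surface of genus (2 − b_{g₁}^o − b_{g₂}^o − b_{g₁g₂}^o + |o|)/2.) -/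
noncomputable section

/-- The number of orbits of the cyclic subgroup `⟨h⟩` that are contained in the subset
`o ⊆ X`. -/
def numOrbitsIn (G : Type) [Group G] (X : Type) [MulAction G X] (h : G) (o : Set X) : ℕ :=
  Nat.card {q : MulAction.orbitRel.Quotient (Subgroup.zpowers h) X //
    MulAction.orbitRel.Quotient.orbit q ⊆ o}

/-- The number of cycles of a permutation, fixed points included, is the number of its nontrivial
cycles plus the number of its fixed points. -/
theorem card_quotient_sameCycle {α : Type*} [Fintype α] [DecidableEq α] (f : Equiv.Perm α) :
    Nat.card (Quotient (Equiv.Perm.SameCycle.setoid f)) =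
      f.cycleFactorsFinset.card + (Finset.univ.filter fun x => f x = x).card := by
  let φ : α → Equiv.Perm α ⊕ α := fun x => if f x = x then .inr x else .inl (f.cycleOf x)
  have hφ : ∀ x y, f.SameCycle x y ↔ φ x = φ y := by
    intro x y
    by_cases hx : f x = x <;> by_cases hy : f y = y
    · simp only [φ, hx, hy, if_true, Sum.inr.injEq]
      exact ⟨fun h => h.eq_of_left hx, fun h => h ▸ .refl _ _⟩
    · simp only [φ, hx, hy, if_true, if_false, reduceCtorEq, iff_false]
      exact fun h => hy (h.apply_eq_self_iff.1 hx)
    · simp only [φ, hx, hy, if_true, if_false, reduceCtorEq, iff_false]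
      exact fun h => hx (h.apply_eq_self_iff.2 hy)
    · simp only [φ, hx, hy, if_false, Sum.inl.injEq]
      exact Equiv.Perm.sameCycle_iff_cycleOf_eq_of_mem_support
        (Equiv.Perm.mem_support.2 hx) (Equiv.Perm.mem_support.2 hy)
  have hker : Equiv.Perm.SameCycle.setoid f = Setoid.ker φ := Setoid.ext hφ
  rw [hker, Nat.card_congr (Setoid.quotientKerEquivRange φ), Nat.card_coe_set_eq,
    ← Finset.card_disjSum, ← Set.ncard_coe_finset]
  congr 1
  ext (c | x)
  · simp only [Set.mem_range, Finset.mem_coe, Finset.inl_mem_disjSum]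
    constructor
    · rintro ⟨x, hx⟩
      by_cases hfx : f x = x
      · simp [φ, hfx] at hx
      · simp only [φ, hfx, if_false, Sum.inl.injEq] at hx
        rw [← hx]
        exact Equiv.Perm.cycleOf_mem_cycleFactorsFinset_iff.2 (Equiv.Perm.mem_support.2 hfx)
    · intro hc
      obtain ⟨x, hx⟩ := (Equiv.Perm.mem_cycleFactorsFinset_iff.1 hc).1.nonempty_support
      refine ⟨x, ?_⟩
      have hfx := Equiv.Perm.mem_support.1 (Equiv.Perm.mem_cycleFactorsFinset_support_le hc hx)
      simp only [φ, hfx, if_false, Sum.inl.injEq]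
      exact (Equiv.Perm.cycle_is_cycleOf hx hc).symm
  · simp only [Set.mem_range, Finset.mem_coe, Finset.inr_mem_disjSum, Finset.mem_filter,
      Finset.mem_univ, true_and]
    constructor
    · rintro ⟨y, hy⟩
      by_cases hfy : f y = y
      · simp only [φ, hfy, if_true, Sum.inr.injEq] at hy
        exact hy ▸ hfy
      · simp [φ, hfy] at hy
    · exact fun hx => ⟨x, by simp [φ, hx]⟩

/-- The sign of a permutation is the parity of the number of points plus the number of cycles,
fixed points included. -/
theorem sign_eq_neg_one_pow_card_add_card_quotient_sameCycle {α : Type*} [Fintype α]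
    [DecidableEq α] (f : Equiv.Perm α) :
    Equiv.Perm.sign f =
      (-1) ^ (Nat.card α + Nat.card (Quotient (Equiv.Perm.SameCycle.setoid f))) := by
  have hcard : f.support.card + (Finset.univ.filter fun x => f x = x).card = Nat.card α := by
    rw [Nat.card_eq_fintype_card, ← Finset.card_univ,
      ← Finset.card_filter_add_card_filter_not (s := Finset.univ) fun x => f x ≠ x]
    simp [Equiv.Perm.support]
  have hcycles : f.cycleType.card = f.cycleFactorsFinset.card := by
    simp [Equiv.Perm.cycleType_def]
  rw [Equiv.Perm.sign_of_cycleType, Equiv.Perm.sum_cycleType, hcycles, card_quotient_sameCycle,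
    ← hcard, neg_one_pow_congr]
  grind

/-- For `h` in a subgroup `H`, the `⟨h⟩`-orbits contained in an `H`-orbit are the cycles of the
permutation induced by `h` on that orbit. -/
theorem numOrbitsIn_orbit {G X : Type} [Group G] [MulAction G X] (H : Subgroup G) (h : H) (x : X) :
    numOrbitsIn G X h (MulAction.orbit H x) = Nat.card (Quotient
      (Equiv.Perm.SameCycle.setoid (MulAction.toPermHom H (MulAction.orbit H x) h))) := by
  have hrel : ∀ y z : MulAction.orbit H x,
      (MulAction.toPermHom H (MulAction.orbit H x) h).SameCycle y z ↔
        MulAction.orbitRel (Subgroup.zpowers (h : G)) X y z := by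
    intro y z
    rw [Equiv.Perm.sameCycle_comm, MulAction.orbitRel_apply, MulAction.mem_orbit_iff,
      Equiv.Perm.SameCycle, Subgroup.exists_zpowers]
    refine exists_congr fun i => ?_
    rw [← map_zpow, Subtype.ext_iff]
    rfl
  refine (Nat.card_eq_of_bijective (Quotient.lift
    (fun y : MulAction.orbit H x => (⟨Quotient.mk _ (y : X), ?_⟩ :
      {q : MulAction.orbitRel.Quotient (Subgroup.zpowers (h : G)) X //
        MulAction.orbitRel.Quotient.orbit q ⊆ MulAction.orbit H x}))
    fun y z hyz => Subtype.ext (Quotient.sound ((hrel y z).1 hyz))) ⟨?_, ?_⟩).symm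
  · rintro _ ⟨⟨g, hg⟩, rfl⟩
    have hgH : g ∈ H := (Subgroup.zpowers_le.2 h.2) hg
    exact MulAction.mem_orbit_of_mem_orbit (⟨g, hgH⟩ : H) y.2
  · rintro ⟨y⟩ ⟨z⟩ hyz
    exact Quotient.sound ((hrel y z).2 (Quotient.exact (congrArg Subtype.val hyz)))
  · rintro ⟨⟨y⟩, hy⟩
    exact ⟨Quotient.mk _ ⟨y, hy (MulAction.mem_orbit_self y)⟩, rfl⟩

/-- For an orbit `o` of `⟨g₁, g₂⟩` on a finite set `X`, the quantity
`2 − b_{g₁}^o − b_{g₂}^o − b_{g₁g₂}^o + |o|` is even, where `b_h^o` is the number of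
`⟨h⟩`-orbits contained in `o`; i.e. the genus formula of Lemma 2.8 yields an integer. -/
theorem genus_formula_even
    (G : Type) [Group G] (X : Type) [Fintype X] [MulAction G X]
    (g₁ g₂ : G) (o : Set X)
    (ho : ∃ x : X, o = MulAction.orbit (Subgroup.closure ({g₁, g₂} : Set G)) x) :
    Even ((2 : ℤ) - (numOrbitsIn G X g₁ o : ℤ) - (numOrbitsIn G X g₂ o : ℤ)
      - (numOrbitsIn G X (g₁ * g₂) o : ℤ) + (Nat.card ↥o : ℤ)) := by
  classical
  obtain ⟨x, rfl⟩ := ho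
  set H := Subgroup.closure ({g₁, g₂} : Set G)
  let h₁ : H := ⟨g₁, Subgroup.subset_closure (by simp)⟩
  let h₂ : H := ⟨g₂, Subgroup.subset_closure (by simp)⟩
  have hsign := map_mul (Equiv.Perm.sign.comp (MulAction.toPermHom H (MulAction.orbit H x))) h₁ h₂
  simp only [MonoidHom.comp_apply, sign_eq_neg_one_pow_card_add_card_quotient_sameCycle,
    ← numOrbitsIn_orbit] at hsign
  rw [← pow_add, ← mul_inv_eq_one, ← inv_pow, inv_neg, inv_one, ← pow_add, Units.ext_iff] at hsign
  push_cast at hsign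
  rw [neg_one_pow_eq_one_iff_even (by decide)] at hsign
  have hg₁ : (h₁ : G) = g₁ := rfl
  have hg₂ : (h₂ : G) = g₂ := rfl
  rw [hg₁, hg₂] at hsign
  grind
end
end

section
/- Let G be a group acting on a finite set X, let g₁, g₂ ∈ G, and let o ⊆ X be an orbit of the subgroup ⟨g₁, g₂⟩ generated by g₁ and g₂. For h ∈ G let b_h^o denote the number of orbits of the cyclic subgroup ⟨h⟩ that are contained in o. Then b_{g₁}^o + b_{g₂}^o + b_{g₁g₂}^o ≤ |o| + 2. (This is the non-negativity of the genus (2 − b_{g₁}^o − b_{g₂}^o − b_{g₁g₂}^o + |o|)/2 of the connected component, corresponding to o, of the induced |o|-fold cover of the three-holed sphere, as computed in Lemma 2.8.) -/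
noncomputable section

/-- The difference operator `f ↦ f ∘ σ - f` on rational functions. -/
def permDiff {Y : Type*} (σ : Equiv.Perm Y) : (Y → ℚ) →ₗ[ℚ] (Y → ℚ) :=
  LinearMap.funLeft ℚ ℚ σ - LinearMap.id

theorem permDiff_apply {Y : Type*} (σ : Equiv.Perm Y) (f : Y → ℚ) (y : Y) :
    permDiff σ f y = f (σ y) - f y := rfl

theorem mem_ker_permDiff {Y : Type*} {σ : Equiv.Perm Y} {f : Y → ℚ} :
    f ∈ LinearMap.ker (permDiff σ) ↔ ∀ y, f (σ y) = f y := by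
  simp [funext_iff, permDiff_apply, sub_eq_zero]

/-- If `f` is `σ`-invariant and `f ∘ τ - f` is of the form `g ∘ σ⁻¹ - g`, then `f` is
`τ`-invariant. -/
theorem invariant_of_sub_eq_sub {Y : Type*} [Fintype Y] {σ τ : Equiv.Perm Y} {f g : Y → ℚ}
    (hf : ∀ y, f (σ y) = f y) (h : ∀ y, f (τ y) - f y = g (σ⁻¹ y) - g y) (y : Y) :
    f (τ y) = f y := by
  have h₁ : ∑ y, f y * g (σ⁻¹ y) = ∑ y, f y * g y := by
    rw [← Equiv.sum_comp σ]
    simp [hf]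
  have h₂ : ∑ y, f (τ y) ^ 2 = ∑ y, f y ^ 2 := Equiv.sum_comp τ fun y => f y ^ 2
  have h₃ : ∑ y, f y * (f (τ y) - f y) = 0 := by
    simp only [h, mul_sub, Finset.sum_sub_distrib, h₁, sub_self]
  have h₄ : ∑ y, (f (τ y) - f y) ^ 2 = 0 := by
    calc ∑ y, (f (τ y) - f y) ^ 2
        = ∑ y, (f (τ y) ^ 2 - f y ^ 2 - 2 * (f y * (f (τ y) - f y))) :=
          Finset.sum_congr rfl fun y _ => by ring
      _ = 0 := by
          rw [Finset.sum_sub_distrib, Finset.sum_sub_distrib, ← Finset.mul_sum, h₂, h₃]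
          ring
  have h₅ := (Finset.sum_eq_zero_iff_of_nonneg fun y _ => sq_nonneg (f (τ y) - f y)).1 h₄ y
    (Finset.mem_univ y)
  exact sub_eq_zero.1 (pow_eq_zero_iff two_ne_zero |>.1 h₅)

/-- Scott's inequality for two permutations whose common invariant functions are constant. -/
theorem finrank_ker_permDiff_add_le {Y : Type*} [Fintype Y] (σ τ : Equiv.Perm Y) (y₀ : Y)
    (hconst : ∀ f : Y → ℚ, (∀ y, f (σ y) = f y) → (∀ y, f (τ y) = f y) → ∀ y, f y = f y₀) :
    Module.finrank ℚ (LinearMap.ker (permDiff σ)) + Module.finrank ℚ (LinearMap.ker (permDiff τ)) +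
      Module.finrank ℚ (LinearMap.ker (permDiff (σ * τ))) ≤ Fintype.card Y + 2 := by
  let A := LinearMap.ker (permDiff σ)
  let B := LinearMap.ker (permDiff τ)
  let Φ : A × B →ₗ[ℚ] LinearMap.range (permDiff (σ * τ)) :=
    (permDiff (σ * τ)).rangeRestrict ∘ₗ
      (A.subtype.coprod (LinearMap.funLeft ℚ ℚ (σ⁻¹ : Equiv.Perm Y) ∘ₗ B.subtype))
  let ev : (Y → ℚ) →ₗ[ℚ] ℚ := LinearMap.proj y₀
  let Ψ : A × B →ₗ[ℚ] LinearMap.range (permDiff (σ * τ)) × ℚ × ℚ :=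
    Φ.prod ((ev ∘ₗ A.subtype).prodMap (ev ∘ₗ B.subtype))
  have hΨ : Function.Injective Ψ := by
    rw [← LinearMap.ker_eq_bot, LinearMap.ker_eq_bot']
    rintro ⟨⟨f, hf⟩, ⟨g, hg⟩⟩ h
    have hf' := mem_ker_permDiff.1 hf
    have hg' := mem_ker_permDiff.1 hg
    have hf₀ : f y₀ = 0 := congrArg (fun p => p.2.1) h
    have hg₀ : g y₀ = 0 := congrArg (fun p => p.2.2) h
    have hΦ (y : Y) : f (τ y) - f y = g (σ⁻¹ y) - g y := by
      have h' : f (σ (τ y)) + g (σ⁻¹ (σ (τ y))) - (f y + g (σ⁻¹ y)) = 0 :=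
        congrArg (fun p => (p.1 : Y → ℚ) y) h
      rw [hf', show σ⁻¹ (σ (τ y)) = τ y from σ.symm_apply_apply _, hg'] at h'
      linarith
    have hfτ := invariant_of_sub_eq_sub hf' hΦ
    have hgσ (y : Y) : g (σ y) = g y := by
      have := hΦ (σ y)
      rw [hfτ, show σ⁻¹ (σ y) = y from σ.symm_apply_apply y] at this
      linarith
    have hf_zero : f = 0 := funext fun y => (hconst f hf' hfτ y).trans hf₀
    have hg_zero : g = 0 := funext fun y => (hconst g hgσ hg' y).trans hg₀
    subst hf_zero hg_zero
    rfl
  have h₁ := LinearMap.finrank_le_finrank_of_injective hΨ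
  have h₂ := (permDiff (σ * τ)).finrank_range_add_finrank_ker
  simp only [Module.finrank_prod, Module.finrank_self, Module.finrank_fintype_fun_eq_card,
    A, B] at h₁ h₂
  omega

/-- Functions on the set of `⟨h⟩`-orbits contained in `o` give `h`-invariant functions on `o`. -/
theorem numOrbitsIn_le_finrank (G : Type) [Group G] (X : Type) [Finite X] [MulAction G X]
    (h : G) (o : Set X) (σ : Equiv.Perm o) (hσ : ∀ y, (σ y : X) = h • (y : X)) :
    numOrbitsIn G X h o ≤ Module.finrank ℚ (LinearMap.ker (permDiff σ)) := by
  let Z := Subgroup.zpowers h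
  let Q := {q : MulAction.orbitRel.Quotient Z X // MulAction.orbitRel.Quotient.orbit q ⊆ o}
  have hinv : ∀ z ∈ Z, ∀ x ∈ o, z • x ∈ o := by
    rintro _ ⟨n, rfl⟩ x hx
    have hn (n : ℤ) : (((σ ^ n) ⟨x, hx⟩ : o) : X) = h ^ n • x := by
      induction n with
      | zero => simp
      | succ n ih => rw [add_comm, zpow_add, zpow_add, Equiv.Perm.mul_apply, zpow_one, hσ, ih,
          zpow_one, mul_smul]
      | pred n ih =>
        rw [sub_eq_neg_add, zpow_add, zpow_add, Equiv.Perm.mul_apply, mul_smul, zpow_neg_one,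
          zpow_neg_one, eq_inv_smul_iff, ← hσ, Equiv.Perm.inv_def, Equiv.apply_symm_apply, ih]
    exact hn n ▸ Subtype.coe_prop _
  let π : o → Q := fun y => ⟨Quotient.mk _ (y : X), by
    rintro _ ⟨⟨z, hz⟩, rfl⟩
    exact hinv z hz y y.2⟩
  have hπ : Function.Surjective π := by
    rintro ⟨q, hq⟩
    induction q using Quotient.inductionOn with
    | h x => exact ⟨⟨x, hq (MulAction.mem_orbit_self x)⟩, rfl⟩
  have hπσ (y : o) : π (σ y) = π y :=
    Subtype.ext (Quotient.sound ⟨⟨h, Subgroup.mem_zpowers h⟩, (hσ y).symm⟩)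
  let Θ : (Q → ℚ) →ₗ[ℚ] LinearMap.ker (permDiff σ) :=
    (LinearMap.funLeft ℚ ℚ π).codRestrict _ fun f =>
      mem_ker_permDiff.2 fun y => congrArg f (hπσ y)
  have hΘ : Function.Injective Θ := fun f g hfg =>
    LinearMap.funLeft_injective_of_surjective ℚ ℚ π hπ (congrArg Subtype.val hfg)
  have : Finite Q := Finite.of_surjective π hπ
  have := Fintype.ofFinite Q
  have hle := LinearMap.finrank_le_finrank_of_injective hΘ
  rw [Module.finrank_fintype_fun_eq_card, ← Nat.card_eq_fintype_card] at hle
  exact hle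

/-- For an orbit `o` of `⟨g₁, g₂⟩` on a finite set `X`, one has
`b_{g₁}^o + b_{g₂}^o + b_{g₁g₂}^o ≤ |o| + 2`, where `b_h^o` is the number of `⟨h⟩`-orbits
contained in `o`; i.e. the genus of Lemma 2.8 is non-negative. -/
theorem genus_formula_nonneg
    (G : Type) [Group G] (X : Type) [Fintype X] [MulAction G X]
    (g₁ g₂ : G) (o : Set X)
    (ho : ∃ x : X, o = MulAction.orbit (Subgroup.closure ({g₁, g₂} : Set G)) x) :
    numOrbitsIn G X g₁ o + numOrbitsIn G X g₂ o + numOrbitsIn G X (g₁ * g₂) o ≤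
      Nat.card ↥o + 2 := by
  classical
  obtain ⟨x, rfl⟩ := ho
  let H := Subgroup.closure ({g₁, g₂} : Set G)
  let a : H := ⟨g₁, Subgroup.subset_closure (by simp)⟩
  let b : H := ⟨g₂, Subgroup.subset_closure (by simp)⟩
  let ρ := MulAction.toPermHom H (MulAction.orbit H x)
  have hρ (c : H) : numOrbitsIn G X c (MulAction.orbit H x) ≤
      Module.finrank ℚ (LinearMap.ker (permDiff (ρ c))) :=
    numOrbitsIn_le_finrank G X c _ (ρ c) fun _ => rfl
  have hconst (f : MulAction.orbit H x → ℚ) (ha : ∀ y, f (ρ a y) = f y)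
      (hb : ∀ y, f (ρ b y) = f y) (y : MulAction.orbit H x) :
      f y = f ⟨x, MulAction.mem_orbit_self x⟩ := by
    have key : ∀ c (hc : c ∈ H), ∀ y, f ((⟨c, hc⟩ : H) • y) = f y := by
      intro c hc
      induction hc using Subgroup.closure_induction with
      | mem c hc =>
        rcases hc with rfl | rfl
        · exact ha
        · exact hb
      | one => exact fun y => congrArg f (one_smul H y)
      | mul c d hc hd ihc ihd =>
        intro y
        exact (congrArg f (mul_smul (⟨c, hc⟩ : H) ⟨d, hd⟩ y)).trans ((ihc _).trans (ihd y))
      | inv c hc ih =>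
        intro y
        rw [← ih]
        exact congrArg f (smul_inv_smul (⟨c, hc⟩ : H) y)
    obtain ⟨_, ⟨c, rfl⟩⟩ := y
    exact key c c.2 ⟨x, MulAction.mem_orbit_self x⟩
  have hab := finrank_ker_permDiff_add_le (ρ a) (ρ b) ⟨x, MulAction.mem_orbit_self x⟩ hconst
  rw [← map_mul, ← Nat.card_eq_fintype_card] at hab
  exact (add_le_add (add_le_add (hρ a) (hρ b)) (hρ (a * b))).trans hab
end
end
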